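/- arXiv:0912.3266 — 2 statements merged into one kernel-verified Lean document; each statement's English description precedes it below -/
import Mathlib

section
/- Let (V,J,⟨·,·⟩) be a pseudo-hermitian vector space with dim_ℝ V = 8, and let η be a real three-form on V of type (3,0)+(0,3) whose length with respect to the induced scalar product on three-forms is non-zero. Then the kernel K_η of η is a J-invariant subspace of complex dimension one which admits an orthogonal complement (K_η)^⊥, and the support satisfies Σ_η = (K_η)^⊥. -/
/-- the support `Σ_η` of a three-form `η` on a vector space with a
nondegenerate symmetric bilinear form `B`. -/
def threeFormSupport {V : Type} [AddCommGroup V] [Module ℝ V]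
    (B : LinearMap.BilinForm ℝ V) (η : V →ₗ[ℝ] V →ₗ[ℝ] V →ₗ[ℝ] ℝ) : Submodule ℝ V :=
  Submodule.span ℝ {u : V | ∃ x y : V, B u = η x y}

section

open Module

variable {V : Type} [AddCommGroup V] [Module ℝ V]

/-- A real three-form of type `(3,0)+(0,3)` with respect to the endomorphism `J`. -/
structure IsThreeZeroForm (J : V →ₗ[ℝ] V) (η : V →ₗ[ℝ] V →ₗ[ℝ] V →ₗ[ℝ] ℝ) : Prop where
  sq_neg : ∀ x, J (J x) = -x
  swap_left : ∀ x y z, η x y z = -η y x z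
  swap_right : ∀ x y z, η x y z = -η x z y
  map_map : ∀ x y z, η (J x) (J y) z = -η x y z

section ComplexStructure

variable {J : V →ₗ[ℝ] V}

theorem linearIndependent_pair_complexStructure (hJ : ∀ x, J (J x) = -x) {v : V} (hv : v ≠ 0) :
    LinearIndependent ℝ ![v, J v] := by
  rw [LinearIndependent.pair_iff]
  intro s t h
  have h' := congrArg J h
  simp only [map_add, map_smul, hJ, map_zero] at h'
  have key : (s ^ 2 + t ^ 2) • v = 0 := by
    have : (s ^ 2 + t ^ 2) • v = s • (s • v + t • J v) - t • (s • J v + t • -v) := by module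
    rw [this, h, h']; simp
  have hst := (smul_eq_zero.1 key).resolve_right hv
  constructor <;> nlinarith [sq_nonneg s, sq_nonneg t]

/-- A `J`-stable real plane lies in every `J`-stable subspace meeting it nontrivially. -/
theorem le_of_complexStructure_of_finrank_eq_two (hJ : ∀ x, J (J x) = -x)
    {K S : Submodule ℝ V} (hK : ∀ x ∈ K, J x ∈ K) (hS : ∀ x ∈ S, J x ∈ S)
    (hfin : finrank ℝ K = 2) {v : V} (hv : v ≠ 0) (hvK : v ∈ K) (hvS : v ∈ S) : K ≤ S := by
  have : FiniteDimensional ℝ K := Module.finite_of_finrank_pos (by omega)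
  have hspan {T : Submodule ℝ V} (hT : v ∈ T) (hJT : J v ∈ T) :
      Submodule.span ℝ (Set.range ![v, J v]) ≤ T := by
    rw [Submodule.span_le]
    rintro _ ⟨i, rfl⟩
    fin_cases i
    exacts [hT, hJT]
  have hrank := finrank_span_eq_card (linearIndependent_pair_complexStructure hJ hv)
  rw [← Submodule.eq_of_le_of_finrank_eq (hspan hvK (hK v hvK)) (by simp [hrank, hfin])]
  exact hspan hvS (hS v hvS)

end ComplexStructure

/-- The linear map `ℝ⁶ → V` with image the complex span of `x`, `y`, `z`. -/
noncomputable def complexCombination (J : V →ₗ[ℝ] V) (x y z : V) : (Fin 6 → ℝ) →ₗ[ℝ] V :=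
  Fintype.linearCombination ℝ ![x, J x, y, J y, z, J z]

theorem complexCombination_apply (J : V →ₗ[ℝ] V) (x y z : V) (c : Fin 6 → ℝ) :
    complexCombination J x y z c =
      c 0 • x + c 1 • J x + c 2 • y + c 3 • J y + c 4 • z + c 5 • J z := by
  simp [complexCombination, Fintype.linearCombination_apply, Fin.sum_univ_succ, ← add_assoc]

theorem range_complexCombination_le {J : V →ₗ[ℝ] V} {S : Submodule ℝ V} (hS : ∀ x ∈ S, J x ∈ S)
    {x y z : V} (hx : x ∈ S) (hy : y ∈ S) (hz : z ∈ S) :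
    (complexCombination J x y z).range ≤ S := by
  rintro _ ⟨c, rfl⟩
  rw [complexCombination_apply]
  have := hS x hx
  have := hS y hy
  have := hS z hz
  repeat' apply Submodule.add_mem
  all_goals exact Submodule.smul_mem _ _ ‹_›

/-- The contractions of `t ⌟ η` with pairs of vectors from `x`, `y`, `z`. -/
noncomputable def contractionMap (J : V →ₗ[ℝ] V) (η : V →ₗ[ℝ] V →ₗ[ℝ] V →ₗ[ℝ] ℝ) (x y z : V) :
    V →ₗ[ℝ] (Fin 6 → ℝ) :=
  LinearMap.pi ![(η.flip y).flip z, (η.flip (J y)).flip z, (η.flip z).flip x,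
    (η.flip (J z)).flip x, (η.flip x).flip y, (η.flip (J x)).flip y]

theorem mem_ker_contractionMap {J : V →ₗ[ℝ] V} {η : V →ₗ[ℝ] V →ₗ[ℝ] V →ₗ[ℝ] ℝ} {x y z t : V} :
    t ∈ (contractionMap J η x y z).ker ↔
      η t y z = 0 ∧ η t (J y) z = 0 ∧ η t z x = 0 ∧ η t (J z) x = 0 ∧ η t x y = 0 ∧
        η t (J x) y = 0 := by
  simp [contractionMap, funext_iff, Fin.forall_fin_succ]

theorem ker_le_ker_contractionMap (J : V →ₗ[ℝ] V)
    (η : V →ₗ[ℝ] V →ₗ[ℝ] V →ₗ[ℝ] ℝ) (x y z : V) :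
    LinearMap.ker η ≤ (contractionMap J η x y z).ker := by
  intro t ht
  rw [LinearMap.mem_ker] at ht
  rw [mem_ker_contractionMap]
  simp [ht]

namespace IsThreeZeroForm

variable {J : V →ₗ[ℝ] V} {η : V →ₗ[ℝ] V →ₗ[ℝ] V →ₗ[ℝ] ℝ}

theorem self_left (h : IsThreeZeroForm J η) (x z : V) : η x x z = 0 := by
  linarith [h.swap_left x x z]

theorem self_right (h : IsThreeZeroForm J η) (x y : V) : η x y y = 0 := by
  linarith [h.swap_right x y y]

theorem self_outer (h : IsThreeZeroForm J η) (x y : V) : η x y x = 0 := by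
  rw [h.swap_right, h.self_left, neg_zero]

theorem rotate (h : IsThreeZeroForm J η) (x y z : V) : η x y z = η y z x := by
  rw [h.swap_left, h.swap_right, neg_neg]

theorem map_left (h : IsThreeZeroForm J η) (x y z : V) : η (J x) y z = η x (J y) z := by
  have := h.map_map x (J y) z
  rw [h.sq_neg] at this
  simpa using this

theorem map_middle (h : IsThreeZeroForm J η) (x y z : V) : η x (J y) z = η x y (J z) := by
  rw [h.rotate, h.map_left, h.rotate, h.rotate]

theorem map_self_left (h : IsThreeZeroForm J η) (x z : V) : η (J x) x z = 0 := by
  have h₁ := h.map_left x x z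
  have h₂ := h.swap_left x (J x) z
  linarith

theorem apply_map_left (h : IsThreeZeroForm J η) (x y : V) : η x y (J x) = 0 := by
  rw [← h.rotate, h.map_self_left]

theorem apply_map_right (h : IsThreeZeroForm J η) (x y : V) : η x y (J y) = 0 := by
  rw [h.swap_left, h.apply_map_left, neg_zero]

theorem ker_stable (h : IsThreeZeroForm J η) : ∀ x ∈ LinearMap.ker η, J x ∈ LinearMap.ker η := by
  intro x hx
  rw [LinearMap.mem_ker] at hx ⊢
  ext y z
  rw [h.map_left, hx]
  rfl

theorem ker_contractionMap_stable (h : IsThreeZeroForm J η) (x y z : V) :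
    ∀ t ∈ (contractionMap J η x y z).ker, J t ∈ (contractionMap J η x y z).ker := by
  intro t ht
  rw [mem_ker_contractionMap] at ht ⊢
  simpa [h.map_left, h.sq_neg, and_left_comm, and_assoc, and_comm] using ht

theorem injective_contractionMap_comp (h : IsThreeZeroForm J η) {x y z : V} (hη : η x y z ≠ 0) :
    Function.Injective (contractionMap J η x y z ∘ₗ complexCombination J x y z) := by
  rw [← LinearMap.ker_eq_bot, LinearMap.ker_eq_bot']
  intro c hc
  have hc' : complexCombination J x y z c ∈ (contractionMap J η x y z).ker := hc
  rw [mem_ker_contractionMap, complexCombination_apply] at hc'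
  have solve {P Q a b : ℝ} (hP : P ≠ 0) (h₁ : a * P + b * Q = 0) (h₂ : a * Q - b * P = 0) :
      a = 0 ∧ b = 0 := by
    have hpos : P ^ 2 + Q ^ 2 ≠ 0 := by positivity
    constructor
    · apply (mul_eq_zero.1 (_ : a * (P ^ 2 + Q ^ 2) = 0)).resolve_right hpos
      linear_combination P * h₁ + Q * h₂
    · apply (mul_eq_zero.1 (_ : b * (P ^ 2 + Q ^ 2) = 0)).resolve_right hpos
      linear_combination Q * h₁ - P * h₂
  have hzx : η z x y = η x y z := h.rotate z x y
  have hyz : η y z x = η x y z := (h.rotate x y z).symm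
  have hyzJ : η y z (J x) = η x y (J z) := by
    rw [← h.rotate, h.map_left, h.map_middle]
  have hzxJ : η z x (J y) = η x y (J z) := by
    rw [h.rotate, ← h.map_middle]
  simp only [map_add, map_smul, LinearMap.add_apply, LinearMap.smul_apply, LinearMap.neg_apply,
    h.map_left,
    h.map_middle, h.sq_neg, map_neg, h.self_left, h.self_outer,
    h.apply_map_left, hzx, hyz, hyzJ, hzxJ, smul_eq_mul, mul_zero, add_zero,
    zero_add, mul_neg, neg_zero, ← sub_eq_add_neg] at hc'
  obtain ⟨h₁, h₂, h₃, h₄, h₅, h₆⟩ := hc'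
  obtain ⟨h0, h1⟩ := solve hη h₁ h₂
  obtain ⟨h2, h3⟩ := solve hη h₃ h₄
  obtain ⟨h4, h5⟩ := solve hη h₅ h₆
  ext i
  fin_cases i <;> assumption

theorem finrank_range_complexCombination (h : IsThreeZeroForm J η) {x y z : V} (hη : η x y z ≠ 0) :
    finrank ℝ (complexCombination J x y z).range = 6 := by
  have hinj := h.injective_contractionMap_comp hη
  rw [LinearMap.coe_comp] at hinj
  rw [LinearMap.finrank_range_of_inj hinj.of_comp]
  simp

theorem disjoint_range_ker (h : IsThreeZeroForm J η) {x y z : V} (hη : η x y z ≠ 0) :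
    Disjoint (complexCombination J x y z).range (contractionMap J η x y z).ker := by
  rw [Submodule.disjoint_def]
  rintro _ ⟨c, rfl⟩ hc
  have : c = 0 := h.injective_contractionMap_comp hη (by simpa using hc)
  rw [this, map_zero]

theorem finrank_ker_contractionMap (h : IsThreeZeroForm J η) (hdim : finrank ℝ V = 8)
    {x y z : V} (hη : η x y z ≠ 0) :
    finrank ℝ (contractionMap J η x y z).ker = 2 := by
  have : FiniteDimensional ℝ V := Module.finite_of_finrank_pos (by omega)
  have hsum := (contractionMap J η x y z).finrank_range_add_finrank_ker
  have hdisj := Submodule.finrank_add_finrank_le_of_disjoint (h.disjoint_range_ker hη)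
  have hle := (contractionMap J η x y z).range.finrank_le
  rw [h.finrank_range_complexCombination hη] at hdisj
  simp only [finrank_fintype_fun_eq_card, Fintype.card_fin] at hle
  omega

theorem range_sup_ker_eq_top (h : IsThreeZeroForm J η) (hdim : finrank ℝ V = 8)
    {x y z : V} (hη : η x y z ≠ 0) :
    (complexCombination J x y z).range ⊔ (contractionMap J η x y z).ker = ⊤ := by
  have : FiniteDimensional ℝ V := Module.finite_of_finrank_pos (by omega)
  have hsum := Submodule.finrank_sup_add_finrank_inf_eq
    (complexCombination J x y z).range (contractionMap J η x y z).ker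
  rw [(h.disjoint_range_ker hη).eq_bot, h.finrank_range_complexCombination hη,
    h.finrank_ker_contractionMap hdim hη, finrank_bot] at hsum
  exact Submodule.eq_top_of_finrank_eq (by omega)

/-- In real dimension eight, a `J`-stable subspace containing `x`, `y`, `z` and a nonzero vector
`t` annihilated by the contractions is everything. -/
theorem eq_top_of_mem (h : IsThreeZeroForm J η) (hdim : finrank ℝ V = 8)
    {x y z t : V} (hη : η x y z ≠ 0) (ht : t ≠ 0)
    (htker : t ∈ (contractionMap J η x y z).ker) {S : Submodule ℝ V} (hS : ∀ x ∈ S, J x ∈ S)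
    (hxS : x ∈ S) (hyS : y ∈ S) (hzS : z ∈ S) (htS : t ∈ S) : S = ⊤ := by
  rw [eq_top_iff, ← h.range_sup_ker_eq_top hdim hη, sup_le_iff]
  exact ⟨range_complexCombination_le hS hxS hyS hzS,
    le_of_complexStructure_of_finrank_eq_two h.sq_neg (h.ker_contractionMap_stable x y z) hS
      (h.finrank_ker_contractionMap hdim hη) ht htker htS⟩

theorem ker_contractionMap_le_ker (h : IsThreeZeroForm J η) (hdim : finrank ℝ V = 8)
    {x y z : V} (hη : η x y z ≠ 0) :
    (contractionMap J η x y z).ker ≤ LinearMap.ker η := by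
  intro t htker
  rcases eq_or_ne t 0 with rfl | ht
  · exact Submodule.zero_mem _
  have hvanish {g : V} (hx : η t g x = 0 ∧ η t g (J x) = 0) (hy : η t g y = 0 ∧ η t g (J y) = 0)
      (hz : η t g z = 0 ∧ η t g (J z) = 0) : η t g = 0 := by
    rw [← LinearMap.ker_eq_top]
    have htop : (η t g).ker ⊓ (η t g).ker.comap J = ⊤ := by
      apply h.eq_top_of_mem hdim hη ht htker
      · rintro w ⟨hw₁, hw₂⟩
        exact ⟨hw₂, by simpa [h.sq_neg] using hw₁⟩
      exacts [hx, hy, hz, ⟨h.self_outer t g, h.apply_map_left t g⟩]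
    exact (inf_eq_top_iff.1 htop).1
  rw [LinearMap.mem_ker, ← LinearMap.ker_eq_top]
  obtain ⟨hyz, hyz', hzx, hzx', hxy, hxy'⟩ := mem_ker_contractionMap.1 htker
  rw [h.map_middle] at hyz' hzx' hxy'
  have flip {a b : V} (hab : η t a b = 0) : η t b a = 0 := by rw [h.swap_right, hab, neg_zero]
  have flip' {a b : V} (hab : η t a (J b) = 0) : η t b (J a) = 0 := by
    rw [← h.map_middle, h.swap_right, hab, neg_zero]
  apply h.eq_top_of_mem hdim hη ht htker
  · intro w hw
    rw [LinearMap.mem_ker] at hw ⊢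
    ext q
    rw [h.map_middle, hw]
    rfl
  · exact hvanish ⟨h.self_right t x, h.apply_map_right t x⟩ ⟨hxy, hxy'⟩ ⟨flip hzx, flip' hzx'⟩
  · exact hvanish ⟨flip hxy, flip' hxy'⟩ ⟨h.self_right t y, h.apply_map_right t y⟩ ⟨hyz, hyz'⟩
  · exact hvanish ⟨hzx, hzx'⟩ ⟨flip hyz, flip' hyz'⟩ ⟨h.self_right t z, h.apply_map_right t z⟩
  · ext q
    exact h.self_left t q

/-- A nonzero `(3,0)+(0,3)`-form in real dimension eight has a two-dimensional kernel. -/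
theorem finrank_ker (h : IsThreeZeroForm J η) (hdim : finrank ℝ V = 8)
    {x y z : V} (hη : η x y z ≠ 0) :
    finrank ℝ (LinearMap.ker η) = 2 := by
  rw [← h.finrank_ker_contractionMap hdim hη]
  rw [le_antisymm (h.ker_contractionMap_le_ker hdim hη) (ker_le_ker_contractionMap J η x y z)]

/-- The form vanishes on a `J`-stable subspace of complex dimension at most two modulo the
kernel. -/
theorem eq_zero_of_finrank_lt (h : IsThreeZeroForm J η) [FiniteDimensional ℝ V] {N : Submodule ℝ V}
    (hN : ∀ x ∈ N, J x ∈ N) (hker : LinearMap.ker η ≤ N)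
    (hfin : finrank ℝ N < finrank ℝ (LinearMap.ker η) + 6) {x y z : V}
    (hx : x ∈ N) (hy : y ∈ N) (hz : z ∈ N) : η x y z = 0 := by
  by_contra hη
  have hdisj := (h.disjoint_range_ker hη).mono_right (ker_le_ker_contractionMap J η x y z)
  have hsum := Submodule.finrank_sup_add_finrank_inf_eq
    (complexCombination J x y z).range (LinearMap.ker η)
  rw [hdisj.eq_bot, finrank_bot, h.finrank_range_complexCombination hη] at hsum
  have hle := Submodule.finrank_mono (sup_le (range_complexCombination_le hN hx hy hz) hker)
  omega

end IsThreeZeroForm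

/-- The metric trace of a bilinear form vanishes if the associated endomorphism is strictly
triangular with respect to a flag `K ≤ Kᗮ`. -/
theorem sum_mul_apply_self_eq_zero [FiniteDimensional ℝ V] {ι : Type*} [Fintype ι]
    [DecidableEq ι] {B : LinearMap.BilinForm ℝ V} (hB : B.Nondegenerate) (hrefl : B.IsRefl)
    {e : ι → V} {ε : ι → ℝ} (hε : ∀ i, ε i = 1 ∨ ε i = -1)
    (he : ∀ i j, B (e i) (e j) = if i = j then ε i else 0)
    (hspan : Submodule.span ℝ (Set.range e) = ⊤) (hcard : Fintype.card ι = finrank ℝ V)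
    {K : Submodule ℝ V} (b : LinearMap.BilinForm ℝ V)
    (hbN : ∀ p ∈ B.orthogonal K, ∀ q ∈ B.orthogonal K, b p q = 0)
    (hbl : ∀ p ∈ K, ∀ q, b p q = 0) (hbr : ∀ q ∈ K, ∀ p, b p q = 0) :
    ∑ i, ε i * b (e i) (e i) = 0 := by
  let A : V →ₗ[ℝ] V := (B.toDual hB).symm.toLinearMap ∘ₗ b
  have hA (x y : V) : B (A x) y = b x y :=
    LinearMap.BilinForm.apply_toDual_symm_apply (hB := hB) _ _
  have hAV (x : V) : A x ∈ B.orthogonal K := by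
    intro n hn
    exact hrefl _ _ ((hA x n).trans (hbr n hn x))
  have hAN (x : V) (hx : x ∈ B.orthogonal K) : A x ∈ K := by
    rw [← LinearMap.BilinForm.orthogonal_orthogonal hB hrefl K]
    intro n hn
    exact hrefl _ _ ((hA x n).trans (hbN x hx n hn))
  have hAK (x : V) (hx : x ∈ K) : A x = 0 := by
    have : b x = 0 := by ext q; exact hbl x hx q
    simp [A, this]
  have hnil : IsNilpotent A := ⟨3, by
    ext x
    exact hAK _ (hAN _ (hAV x))⟩
  have htr := (LinearMap.isNilpotent_trace_of_isNilpotent hnil).eq_zero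
  let E : Basis ι ℝ V :=
    Basis.mk (linearIndependent_of_top_le_span_of_card_eq_finrank hspan.ge hcard) hspan.ge
  have hE (i : ι) : E i = e i := Basis.mk_apply _ _ i
  have hcoord (v : V) (i : ι) : B v (e i) = E.repr v i * ε i := by
    conv_lhs => rw [← E.sum_repr v]
    simp [hE, he]
  rw [LinearMap.trace_eq_matrix_trace ℝ E, Matrix.trace] at htr
  rw [← htr]
  refine Finset.sum_congr rfl fun i _ => ?_
  rw [Matrix.diag_apply, LinearMap.toMatrix_apply, hE, ← hA, hcoord]
  rcases hε i with hi | hi <;> rw [hi] <;> ring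

namespace IsThreeZeroForm

variable {J : V →ₗ[ℝ] V} {η : V →ₗ[ℝ] V →ₗ[ℝ] V →ₗ[ℝ] ℝ}

/-- A form whose kernel is a null complex line has zero length. -/
theorem length_eq_zero_of_ker_le_orthogonal (h : IsThreeZeroForm J η)
    [FiniteDimensional ℝ V] {ι : Type*} [Fintype ι] [DecidableEq ι]
    {B : LinearMap.BilinForm ℝ V} (hB : B.Nondegenerate) (hrefl : B.IsRefl)
    {e : ι → V} {ε : ι → ℝ} (hε : ∀ i, ε i = 1 ∨ ε i = -1)
    (he : ∀ i j, B (e i) (e j) = if i = j then ε i else 0)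
    (hspan : Submodule.span ℝ (Set.range e) = ⊤) (hcard : Fintype.card ι = finrank ℝ V)
    (hN : ∀ x ∈ B.orthogonal (LinearMap.ker η), J x ∈ B.orthogonal (LinearMap.ker η))
    (hker : LinearMap.ker η ≤ B.orthogonal (LinearMap.ker η))
    (hfin : finrank ℝ (B.orthogonal (LinearMap.ker η)) < finrank ℝ (LinearMap.ker η) + 6) :
    ∑ i, ∑ j, ∑ k, ε i * ε j * ε k * (η (e i) (e j) (e k)) ^ 2 = 0 := by
  have trace_zero := sum_mul_apply_self_eq_zero hB hrefl hε he hspan hcard (K := LinearMap.ker η)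
  have hl {p : V} (hp : p ∈ LinearMap.ker η) (y z : V) : η p y z = 0 := by
    rw [LinearMap.mem_ker.1 hp]; rfl
  have hm {p : V} (hp : p ∈ LinearMap.ker η) (x z : V) : η x p z = 0 := by
    rw [h.swap_left, hl hp, neg_zero]
  have hr {p : V} (hp : p ∈ LinearMap.ker η) (x y : V) : η x y p = 0 := by
    rw [h.swap_right, hm hp, neg_zero]
  have one_forms {x z : V} (hx : x ∈ B.orthogonal (LinearMap.ker η))
      (hz : z ∈ B.orthogonal (LinearMap.ker η)) (y w : V) :
      ∑ k, ε k * (η x z (e k) * η y w (e k)) = 0 := by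
    refine trace_zero (LinearMap.BilinForm.linMulLin (η x z) (η y w)) ?_ ?_ ?_
    · intro p hp q _
      simp [LinearMap.BilinForm.linMulLin_apply, h.eq_zero_of_finrank_lt hN hker hfin hx hz hp]
    · intro p hp q
      simp [LinearMap.BilinForm.linMulLin_apply, hr hp]
    · intro q hq p
      simp [LinearMap.BilinForm.linMulLin_apply, hr hq]
  have two_forms {x y : V} (hx : x ∈ B.orthogonal (LinearMap.ker η))
      (hy : y ∈ B.orthogonal (LinearMap.ker η)) :
      ∑ j, ε j * ∑ k, ε k * (η x (e j) (e k) * η y (e j) (e k)) = 0 := by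
    have key := trace_zero (∑ k, ε k •
      LinearMap.BilinForm.linMulLin ((η x).flip (e k)) ((η y).flip (e k))) ?_ ?_ ?_
    · simpa [LinearMap.sum_apply, LinearMap.BilinForm.linMulLin_apply] using key
    · intro p hp q _
      simpa [LinearMap.sum_apply, LinearMap.BilinForm.linMulLin_apply] using one_forms hx hp y q
    · intro p hp q
      simp [LinearMap.sum_apply, LinearMap.BilinForm.linMulLin_apply, hm hp]
    · intro q hq p
      simp [LinearMap.sum_apply, LinearMap.BilinForm.linMulLin_apply, hm hq]
  have key := trace_zero (∑ j, ε j • ∑ k, ε k •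
    LinearMap.BilinForm.linMulLin ((η.flip (e j)).flip (e k)) ((η.flip (e j)).flip (e k))) ?_ ?_ ?_
  · rw [← key]
    simp only [LinearMap.sum_apply, LinearMap.smul_apply, LinearMap.BilinForm.linMulLin_apply,
      LinearMap.flip_apply, smul_eq_mul, Finset.mul_sum]
    refine Finset.sum_congr rfl fun i _ => Finset.sum_congr rfl fun j _ =>
      Finset.sum_congr rfl fun k _ => ?_
    ring
  · intro p hp q hq
    simpa [LinearMap.sum_apply, LinearMap.BilinForm.linMulLin_apply] using two_forms hp hq
  · intro p hp q
    simp [LinearMap.sum_apply, LinearMap.BilinForm.linMulLin_apply, hl hp]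
  · intro q hq p
    simp [LinearMap.sum_apply, LinearMap.BilinForm.linMulLin_apply, hl hq]

/-- The support is always the orthogonal complement of the kernel. -/
theorem support_eq_orthogonal_ker (h : IsThreeZeroForm J η) [FiniteDimensional ℝ V]
    {B : LinearMap.BilinForm ℝ V} (hB : B.Nondegenerate) (hrefl : B.IsRefl) :
    threeFormSupport B η = B.orthogonal (LinearMap.ker η) := by
  apply le_antisymm
  · rw [threeFormSupport, Submodule.span_le]
    rintro u ⟨x, y, hu⟩ n hn
    apply hrefl
    rw [hu, ← h.rotate, LinearMap.mem_ker.1 hn]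
    rfl
  · rw [← LinearMap.BilinForm.orthogonal_orthogonal hB hrefl (threeFormSupport B η)]
    apply LinearMap.BilinForm.orthogonal_le
    intro x hx
    rw [LinearMap.mem_ker]
    ext y z
    rw [h.rotate]
    have hu : B ((B.toDual hB).symm (η y z)) = η y z := by
      ext w
      exact LinearMap.BilinForm.apply_toDual_symm_apply _ _
    rw [← hu]
    exact hx _ (Submodule.subset_span ⟨y, z, hu⟩)

end IsThreeZeroForm

end

/-- Lemma `four_dim_form_lemma`. Let `(V, J, ⟨·,·⟩)` be a
pseudo-Hermitian vector space of real dimension 8 and let `η` be a real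
three-form of type `(3,0)+(0,3)` of non-vanishing length (the length being
computed in any orthonormal basis).  Then the kernel `K_η` is a `J`-invariant
subspace of complex dimension one (real dimension two) admitting an orthogonal
complement `K_η^⊥`, and the support satisfies `Σ_η = K_η^⊥`. -/
theorem eight_dim_three_form_kernel
    {V : Type} [AddCommGroup V] [Module ℝ V]
    (hdim : Module.finrank ℝ V = 8)
    (B : LinearMap.BilinForm ℝ V) (hB : B.Nondegenerate)
    (hBsymm : ∀ x y : V, B x y = B y x)
    (J : V →ₗ[ℝ] V) (hJ : ∀ x, J (J x) = -x)
    (hherm : ∀ x y : V, B (J x) (J y) = B x y)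
    (η : V →ₗ[ℝ] V →ₗ[ℝ] V →ₗ[ℝ] ℝ)
    (halt : ∀ x y : V, η x x y = 0 ∧ η x y y = 0 ∧ η x y x = 0)
    (htype : ∀ x y z : V, η (J x) (J y) z = -η x y z)
    (hlen : ∃ (e : Fin 8 → V) (ε : Fin 8 → ℝ),
      (∀ i, ε i = 1 ∨ ε i = -1) ∧
      (∀ i j, B (e i) (e j) = if i = j then ε i else 0) ∧
      Submodule.span ℝ (Set.range e) = ⊤ ∧
      (∑ i, ∑ j, ∑ k, ε i * ε j * ε k * (η (e i) (e j) (e k)) ^ 2) ≠ 0) :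
    (∀ x ∈ LinearMap.ker η, J x ∈ LinearMap.ker η) ∧
    Module.finrank ℝ (LinearMap.ker η) = 2 ∧
    IsCompl (LinearMap.ker η) (B.orthogonal (LinearMap.ker η)) ∧
    threeFormSupport B η = B.orthogonal (LinearMap.ker η) := by
  obtain ⟨e, ε, hε, he, hspan, hlen⟩ := hlen
  have hfinite : FiniteDimensional ℝ V := Module.finite_of_finrank_pos (by omega)
  have hrefl : B.IsRefl := fun x y hxy => (hBsymm y x).trans hxy
  have h : IsThreeZeroForm J η := by
    refine ⟨hJ, fun x y z => ?_, fun x y z => ?_, htype⟩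
    · have key := (halt (x + y) z).1
      simp only [map_add, LinearMap.add_apply, (halt x z).1, (halt y z).1] at key
      linarith
    · have key := (halt x (y + z)).2.1
      simp only [map_add, LinearMap.add_apply, (halt x y).2.1, (halt x z).2.1] at key
      linarith
  have hrank : Module.finrank ℝ (LinearMap.ker η) = 2 := by
    by_contra hne
    have hzero (x y z : V) : η x y z = 0 := by
      by_contra hη
      exact hne (h.finrank_ker hdim hη)
    exact hlen (by simp [hzero])
  have hN : ∀ x ∈ B.orthogonal (LinearMap.ker η), J x ∈ B.orthogonal (LinearMap.ker η) := by
    intro x hx n hn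
    have hJn : B (J n) x = 0 := hx _ (h.ker_stable n hn)
    have hswap := hherm (J n) x
    rw [hJ, hJn] at hswap
    simpa using hswap
  refine ⟨h.ker_stable, hrank, ?_, h.support_eq_orthogonal_ker hB hrefl⟩
  rw [LinearMap.BilinForm.isCompl_orthogonal_iff_disjoint hrefl, Submodule.disjoint_def]
  intro v hvK hvN
  by_contra hv
  have hker := le_of_complexStructure_of_finrank_eq_two hJ h.ker_stable hN hrank hv hvK hvN
  refine hlen (h.length_eq_zero_of_ker_le_orthogonal hB hrefl hε he hspan (by simp [hdim]) hN
    hker ?_)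
  rw [LinearMap.BilinForm.finrank_orthogonal hB, hrank, hdim]
  norm_num
end

section
/- Let π : (M,g) → (N,h) be a pseudo-Riemannian submersion with complex structure J on M compatible with the splitting TM = H ⊕ V into horizontal and vertical distributions. Then (M,g,J) is pseudo-Kähler (∇J = 0) if and only if the following hold for all horizontal vector fields X,Y and vertical vector fields U,V: π_H((∇_X J)Y) = π_H((∇_V J)X) = 0; (∇^V_U J)V = π_V((∇_X J)V) = 0; A_X(JY) = J A_X Y and A_X(JV) = J A_X V; T_V(JX) = J T_V X and T_U(JV) = J T_U V. -/
/-!  Algebraic (Koszul-style) model of an almost pseudo-Hermitian manifold.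
`Pt` is the set of points, `F` the algebra of smooth functions, `X` the
module of smooth vector fields. -/
structure APH (Pt F X : Type) [TopologicalSpace Pt] [CommRing F] [Algebra ℝ F]
    [AddCommGroup X] [Module F X] : Type where
  /-- evaluation of functions at points -/
  ev : Pt → F →+* ℝ
  ev_alg : ∀ (p : Pt) (c : ℝ), ev p (algebraMap ℝ F c) = c
  /-- abstract geodesic completeness of the underlying pseudo-Riemannian manifold -/
  geodesicallyComplete : Prop
  /-- derivative of a function in the direction of a vector field -/
  D : X → F → F
  D_add : ∀ x f₁ f₂, D x (f₁ + f₂) = D x f₁ + D x f₂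
  D_mul : ∀ x f₁ f₂, D x (f₁ * f₂) = f₁ * D x f₂ + f₂ * D x f₁
  D_addX : ∀ x y f, D (x + y) f = D x f + D y f
  D_smulX : ∀ (h : F) x f, D (h • x) f = h * D x f
  /-- the Lie bracket of vector fields -/
  bracket : X → X → X
  /-- the pseudo-Riemannian metric -/
  g : X → X → F
  g_symm : ∀ x y, g x y = g y x
  g_addL : ∀ x y z, g (x + y) z = g x z + g y z
  g_smulL : ∀ (f : F) x y, g (f • x) y = f * g x y
  g_nondeg : ∀ x, (∀ y, g x y = 0) → x = 0
  /-- the almost complex structure -/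
  J : X → X
  J_add : ∀ x y, J (x + y) = J x + J y
  J_smul : ∀ (f : F) x, J (f • x) = f • J x
  J_sq : ∀ x, J (J x) = -x
  hermitian : ∀ x y, g (J x) (J y) = g x y
  /-- the Levi-Civita connection -/
  nabla : X → X → X
  nabla_addL : ∀ x y z, nabla (x + y) z = nabla x z + nabla y z
  nabla_smulL : ∀ (f : F) x y, nabla (f • x) y = f • nabla x y
  nabla_addR : ∀ x y z, nabla x (y + z) = nabla x y + nabla x z
  nabla_leibniz : ∀ x (f : F) y, nabla x (f • y) = D x f • y + f • nabla x y
  torsion_free : ∀ x y, nabla x y - nabla y x = bracket x y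
  metric_compat : ∀ x y z, D x (g y z) = g (nabla x y) z + g y (nabla x z)

namespace APH

variable {Pt F X : Type} [TopologicalSpace Pt] [CommRing F] [Algebra ℝ F]
  [AddCommGroup X] [Module F X]

/-- `(∇_x J) y` -/
def nJ (Γ : APH Pt F X) (x y : X) : X := Γ.nabla x (Γ.J y) - Γ.J (Γ.nabla x y)

/-- the nearly pseudo-Kähler condition `(∇_X J) X = 0`. -/
def NearlyKahler (Γ : APH Pt F X) : Prop := ∀ x, Γ.nJ x x = 0

/-- the pseudo-Kähler condition `∇ J = 0`. -/
def PseudoKahler (Γ : APH Pt F X) : Prop := ∀ x y, Γ.nJ x y = 0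

/-- strictness: `∇_X J ≠ 0` for `X ≠ 0`. -/
def Strict (Γ : APH Pt F X) : Prop := ∀ x, x ≠ 0 → ∃ y, Γ.nJ x y ≠ 0

/-- the canonical Hermitian connection `∇̄_X Y = ∇_X Y - (1/2) J (∇_X J) Y`. -/
noncomputable def nbar (Γ : APH Pt F X) (x y : X) : X :=
  Γ.nabla x y - (algebraMap ℝ F (1 / 2)) • Γ.J (Γ.nJ x y)

/-- the torsion `T̄(X,Y) = -J (∇_X J) Y` of the canonical Hermitian connection. -/
def Tbar (Γ : APH Pt F X) (x y : X) : X := -Γ.J (Γ.nJ x y)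

/-- the curvature operator of the Levi-Civita connection. -/
def Rm (Γ : APH Pt F X) (x y z : X) : X :=
  Γ.nabla x (Γ.nabla y z) - Γ.nabla y (Γ.nabla x z) - Γ.nabla (Γ.bracket x y) z

/-- the (0,4) Riemannian curvature tensor `R(W,X,Y,Z) = g(R(W,X)Y,Z)`. -/
def R4 (Γ : APH Pt F X) (w x y z : X) : F := Γ.g (Γ.Rm w x y) z

/-- the curvature operator of the canonical Hermitian connection. -/
noncomputable def Rmbar (Γ : APH Pt F X) (x y z : X) : X :=
  Γ.nbar x (Γ.nbar y z) - Γ.nbar y (Γ.nbar x z) - Γ.nbar (Γ.bracket x y) z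

/-- the (0,4) curvature tensor of the canonical Hermitian connection. -/
noncomputable def R4bar (Γ : APH Pt F X) (w x y z : X) : F := Γ.g (Γ.Rmbar w x y) z

/-- an orthonormal frame of vector fields with signs `ε i = ±1`. -/
def IsFrame (Γ : APH Pt F X) {n : ℕ} (e : Fin n → X) (ε : Fin n → ℝ) : Prop :=
  (∀ i, ε i = 1 ∨ ε i = -1) ∧
  (∀ i j, Γ.g (e i) (e j) = algebraMap ℝ F (if i = j then ε i else 0)) ∧
  Submodule.span F (Set.range e) = ⊤

/-- an orthogonal, `J`-invariant, `∇̄`-parallel splitting `TM = H ⊕ V`. -/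
structure Splitting (Γ : APH Pt F X) (H V : Submodule F X) : Prop where
  compl : IsCompl H V
  orth : ∀ x ∈ H, ∀ v ∈ V, Γ.g x v = 0
  JH : ∀ x ∈ H, Γ.J x ∈ H
  JV : ∀ v ∈ V, Γ.J v ∈ V
  parH : ∀ u : X, ∀ x ∈ H, Γ.nbar u x ∈ H
  parV : ∀ u : X, ∀ v ∈ V, Γ.nbar u v ∈ V

end APH
/-- A bundled carrier for a geometric package (points, functions, vector fields). -/
structure Carrier : Type 1 where
  Pt : Type
  F : Type
  X : Type
  [topPt : TopologicalSpace Pt]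
  [ringF : CommRing F]
  [algF : Algebra ℝ F]
  [grpX : AddCommGroup X]
  [modX : Module F X]

attribute [instance] Carrier.topPt Carrier.ringF Carrier.algF Carrier.grpX Carrier.modX

namespace APH

variable {Pt F X : Type} [TopologicalSpace Pt] [CommRing F] [Algebra ℝ F]
  [AddCommGroup X] [Module F X]

/-- An `ε`-quaternionic Kähler structure on an almost pseudo-Hermitian package:
three anti-commuting endomorphism fields `J₁, J₂, J₃ = J₁ J₂` with `Jᵢ² = εᵢ Id`,
skew-symmetric for `g`, spanning a rank-3 bundle `Q` preserved by the Levi-Civita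
connection (with connection one-forms `θᵢ`). -/
structure QKStructure (Γ : APH Pt F X) (ε₁ ε₂ ε₃ : ℝ) : Type where
  J1 : X → X
  J2 : X → X
  J3 : X → X
  J1_add : ∀ x y, J1 (x + y) = J1 x + J1 y
  J1_smul : ∀ (f : F) x, J1 (f • x) = f • J1 x
  J2_add : ∀ x y, J2 (x + y) = J2 x + J2 y
  J2_smul : ∀ (f : F) x, J2 (f • x) = f • J2 x
  J3_add : ∀ x y, J3 (x + y) = J3 x + J3 y
  J3_smul : ∀ (f : F) x, J3 (f • x) = f • J3 x
  J1_sq : ∀ x, J1 (J1 x) = algebraMap ℝ F ε₁ • x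
  J2_sq : ∀ x, J2 (J2 x) = algebraMap ℝ F ε₂ • x
  J3_sq : ∀ x, J3 (J3 x) = algebraMap ℝ F ε₃ • x
  anticomm : ∀ x, J1 (J2 x) = -J2 (J1 x)
  triple : ∀ x, J3 x = J1 (J2 x)
  skew1 : ∀ x y, Γ.g (J1 x) y = -Γ.g x (J1 y)
  skew2 : ∀ x y, Γ.g (J2 x) y = -Γ.g x (J2 y)
  skew3 : ∀ x y, Γ.g (J3 x) y = -Γ.g x (J3 y)
  θ1 : X → F
  θ2 : X → F
  θ3 : X → F
  par1 : ∀ x y, Γ.nabla x (J1 y) - J1 (Γ.nabla x y)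
      = -(θ3 x * algebraMap ℝ F ε₂) • J2 y + (θ2 x * algebraMap ℝ F ε₃) • J3 y
  par2 : ∀ x y, Γ.nabla x (J2 y) - J2 (Γ.nabla x y)
      = -(θ1 x * algebraMap ℝ F ε₃) • J3 y + (θ3 x * algebraMap ℝ F ε₁) • J1 y
  par3 : ∀ x y, Γ.nabla x (J3 y) - J3 (Γ.nabla x y)
      = -(θ2 x * algebraMap ℝ F ε₁) • J1 y + (θ1 x * algebraMap ℝ F ε₂) • J2 y

/-- the canonical variation `g_t` of the metric determined by the projections
`pH`, `pV` onto the two factors of a splitting. -/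
noncomputable def gvar (Γ : APH Pt F X) (t : ℝ) (pH pV : X → X) (x y : X) : F :=
  Γ.g (pH x) (pH y) + algebraMap ℝ F t * Γ.g (pV x) (pV y)

/-- the almost complex structure obtained by flipping the sign of `J` on the
vertical distribution. -/
def Jflip (Γ : APH Pt F X) (pH pV : X → X) (x : X) : X := Γ.J (pH x) - Γ.J (pV x)

/-- the O'Neill tensor `A` of a pseudo-Riemannian submersion with horizontal
and vertical projections `pH`, `pV`. -/
def Aop (Γ : APH Pt F X) (pH pV : X → X) (ζ η : X) : X :=
  pH (Γ.nabla (pH ζ) (pV η)) + pV (Γ.nabla (pH ζ) (pH η))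

/-- the O'Neill tensor `T` of a pseudo-Riemannian submersion with horizontal
and vertical projections `pH`, `pV`. -/
def Top (Γ : APH Pt F X) (pH pV : X → X) (ζ η : X) : X :=
  pH (Γ.nabla (pV ζ) (pV η)) + pV (Γ.nabla (pV ζ) (pH η))

/-- `(M, gc, Jc)` is (isometrically biholomorphically) realized as the twistor
space, with its canonical pseudo-Kähler structure, of an `ε`-quaternionic Kähler
manifold `N`: there is a pseudo-Riemannian submersion onto `N` (encoded by the
pullback of functions `pull` and the horizontal lift `lift`), the Levi-Civita
connection `nc` of `gc` makes `(gc, Jc)` pseudo-Kähler, and along horizontal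
lifts `Jc` is given by a compatible almost complex structure `a J₁ + b J₂ + c J₃`,
`A² = -Id`, of the quaternionic structure of the base. -/
structure TwistorRealization (Γ : APH Pt F X) (gc : X → X → F) (Jc : X → X)
    (ε₁ ε₂ ε₃ : ℝ) : Type 1 where
  base : Carrier
  ΓN : APH base.Pt base.F base.X
  dimN : ℕ
  eN : Fin dimN → base.X
  εN : Fin dimN → ℝ
  frameN : ΓN.IsFrame eN εN
  qk : QKStructure ΓN ε₁ ε₂ ε₃
  pull : base.F →+* F
  pull_alg : ∀ c : ℝ, pull (algebraMap ℝ base.F c) = algebraMap ℝ F c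
  lift : base.X → X
  lift_add : ∀ x y, lift (x + y) = lift x + lift y
  lift_smul : ∀ (f : base.F) (x : base.X), lift (f • x) = pull f • lift x
  isometric : ∀ x y, gc (lift x) (lift y) = pull (ΓN.g x y)
  /-- the Levi-Civita connection of the metric `gc` -/
  nc : X → X → X
  nc_addL : ∀ x y z, nc (x + y) z = nc x z + nc y z
  nc_smulL : ∀ (f : F) x y, nc (f • x) y = f • nc x y
  nc_addR : ∀ x y z, nc x (y + z) = nc x y + nc x z
  nc_leibniz : ∀ x (f : F) y, nc x (f • y) = Γ.D x f • y + f • nc x y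
  nc_torsion_free : ∀ x y, nc x y - nc y x = Γ.bracket x y
  nc_metric : ∀ x y z, Γ.D x (gc y z) = gc (nc x y) z + gc y (nc x z)
  /-- `(gc, Jc)` is a pseudo-Kähler structure -/
  pseudoKahler : ∀ x y, nc x (Jc y) = Jc (nc x y)
  fiber_compat : ∃ a b c : F,
      a ^ 2 * algebraMap ℝ F ε₁ + b ^ 2 * algebraMap ℝ F ε₂ + c ^ 2 * algebraMap ℝ F ε₃ = -1 ∧
      ∀ x, Jc (lift x) = a • lift (qk.J1 x) + b • lift (qk.J2 x) + c • lift (qk.J3 x)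

end APH

/-- The components of `a + b`, where `a` lies in `H` and `b` in `V`, are `a` and `b`. -/
lemma proj_add_eq {F X : Type*} [Ring F] [AddCommGroup X] [Module F X]
    {H V : Submodule F X} (hHV : Disjoint H V)
    {pH pV : X → X} (hpH : ∀ x, pH x ∈ H) (hpV : ∀ x, pV x ∈ V) (hsum : ∀ x, pH x + pV x = x)
    {a b : X} (ha : a ∈ H) (hb : b ∈ V) : pH (a + b) = a ∧ pV (a + b) = b := by
  have key : pH (a + b) - a = b - pV (a + b) := by
    rw [sub_eq_sub_iff_add_eq_add, hsum, add_comm]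
  have hzero : pH (a + b) - a = 0 :=
    Submodule.disjoint_def.1 hHV _ (H.sub_mem (hpH _) ha) (key ▸ V.sub_mem hb (hpV _))
  exact ⟨sub_eq_zero.1 hzero, (sub_eq_zero.1 (key.symm.trans hzero)).symm⟩

namespace APH

variable {Pt F X : Type} [TopologicalSpace Pt] [CommRing F] [Algebra ℝ F]
  [AddCommGroup X] [Module F X]

lemma nabla_zero (Γ : APH Pt F X) (x : X) : Γ.nabla x 0 = 0 := by
  simpa using Γ.nabla_addR x 0 0

lemma nJ_addL (Γ : APH Pt F X) (x y z : X) : Γ.nJ (x + y) z = Γ.nJ x z + Γ.nJ y z := by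
  simp only [nJ, nabla_addL, J_add]
  abel

lemma nJ_addR (Γ : APH Pt F X) (x y z : X) : Γ.nJ x (y + z) = Γ.nJ x y + Γ.nJ x z := by
  simp only [nJ, nabla_addR, J_add]
  abel

/-- Projecting `(∇_x J) y` by a map that is additive and commutes with `J`. -/
lemma proj_nJ_eq_zero_iff (Γ : APH Pt F X) {p : X → X} (hsub : ∀ x y, p (x - y) = p x - p y)
    (hJ : ∀ x, p (Γ.J x) = Γ.J (p x)) (x y : X) :
    p (Γ.nJ x y) = 0 ↔ p (Γ.nabla x (Γ.J y)) = Γ.J (p (Γ.nabla x y)) := by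
  rw [nJ, hsub, hJ, sub_eq_zero]

end APH

open APH in
/-- **Statement 12** (Lemma `lemmaKaehler_subdata`). Let `π : (M,g) → (N,h)`
be a pseudo-Riemannian submersion with a complex structure `J` on `M`
compatible with the splitting `TM = H ⊕ V`.  Then `(M,g,J)` is pseudo-Kähler
iff: `π_H((∇_X J)Y) = π_H((∇_V J)X) = 0`, `(∇^V_U J)V = π_V((∇_X J)V) = 0`,
`A` commutes with `J`, and `T` commutes with `J` (for horizontal `X, Y` and
vertical `U, V`). -/
theorem pseudoKahler_submersion_characterization
    {Pt F X : Type} [TopologicalSpace Pt] [CommRing F] [Algebra ℝ F]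
    [AddCommGroup X] [Module F X]
    {Pt' F' X' : Type} [TopologicalSpace Pt'] [CommRing F'] [Algebra ℝ F']
    [AddCommGroup X'] [Module F' X']
    (Γ : APH Pt F X) (ΓN : APH Pt' F' X')
    -- the pseudo-Riemannian submersion π : M → N, via pullback and horizontal lift
    (pull : F' →+* F) (pull_alg : ∀ c : ℝ, pull (algebraMap ℝ F' c) = algebraMap ℝ F c)
    (lift : X' → X)
    (lift_add : ∀ x y, lift (x + y) = lift x + lift y)
    (lift_smul : ∀ (f : F') (x : X'), lift (f • x) = pull f • lift x)
    (lift_isometric : ∀ x y, Γ.g (lift x) (lift y) = pull (ΓN.g x y))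
    -- the horizontal and vertical distributions with their projections
    (H V : Submodule F X)
    (hH : H = Submodule.span F (Set.range lift))
    (hV : ∀ v : X, v ∈ V ↔ ∀ x ∈ H, Γ.g v x = 0)
    (hcompl : IsCompl H V)
    (pH pV : X → X)
    (hpH : ∀ x : X, pH x ∈ H) (hpV : ∀ x : X, pV x ∈ V)
    (hsum : ∀ x : X, pH x + pV x = x)
    -- J is compatible with the splitting
    (hJH : ∀ x ∈ H, Γ.J x ∈ H) (hJV : ∀ v ∈ V, Γ.J v ∈ V) :
    Γ.PseudoKahler ↔
      ((∀ x ∈ H, ∀ y ∈ H, pH (Γ.nJ x y) = 0) ∧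
       (∀ v ∈ V, ∀ x ∈ H, pH (Γ.nJ v x) = 0) ∧
       (∀ u ∈ V, ∀ v ∈ V, pV (Γ.nJ u v) = 0) ∧
       (∀ x ∈ H, ∀ v ∈ V, pV (Γ.nJ x v) = 0) ∧
       (∀ x ∈ H, ∀ y ∈ H, Γ.Aop pH pV x (Γ.J y) = Γ.J (Γ.Aop pH pV x y)) ∧
       (∀ x ∈ H, ∀ v ∈ V, Γ.Aop pH pV x (Γ.J v) = Γ.J (Γ.Aop pH pV x v)) ∧
       (∀ v ∈ V, ∀ x ∈ H, Γ.Top pH pV v (Γ.J x) = Γ.J (Γ.Top pH pV v x)) ∧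
       (∀ u ∈ V, ∀ v ∈ V, Γ.Top pH pV u (Γ.J v) = Γ.J (Γ.Top pH pV u v))) := by
  have hproj {a b : X} (ha : a ∈ H) (hb : b ∈ V) :=
    proj_add_eq hcompl.disjoint hpH hpV hsum ha hb
  have hHH {x} (hx : x ∈ H) : pH x = x ∧ pV x = 0 := by simpa using hproj hx V.zero_mem
  have hVV {v} (hv : v ∈ V) : pH v = 0 ∧ pV v = v := by simpa using hproj H.zero_mem hv
  have hsub (x y : X) : pH (x - y) = pH x - pH y ∧ pV (x - y) = pV x - pV y := by
    have h := hproj (H.sub_mem (hpH x) (hpH y)) (V.sub_mem (hpV x) (hpV y))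
    rwa [sub_add_sub_comm, hsum, hsum] at h
  have hJ (x : X) : pH (Γ.J x) = Γ.J (pH x) ∧ pV (Γ.J x) = Γ.J (pV x) := by
    have h := hproj (hJH _ (hpH x)) (hJV _ (hpV x))
    rwa [← Γ.J_add, hsum] at h
  have hiffH (x y : X) := Γ.proj_nJ_eq_zero_iff (fun a b => (hsub a b).1) (fun a => (hJ a).1) x y
  have hiffV (x y : X) := Γ.proj_nJ_eq_zero_iff (fun a b => (hsub a b).2) (fun a => (hJ a).2) x y
  have hAH : ∀ x ∈ H, ∀ y ∈ H, (Γ.Aop pH pV x (Γ.J y) = Γ.J (Γ.Aop pH pV x y) ↔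
      pV (Γ.nJ x y) = 0) := fun x hx y hy => by
    simp [Aop, hHH hx, hHH hy, hHH (hJH y hy), nabla_zero, hHH H.zero_mem, hiffV]
  have hAV : ∀ x ∈ H, ∀ v ∈ V, (Γ.Aop pH pV x (Γ.J v) = Γ.J (Γ.Aop pH pV x v) ↔
      pH (Γ.nJ x v) = 0) := fun x hx v hv => by
    simp [Aop, hHH hx, hVV hv, hVV (hJV v hv), nabla_zero, hHH H.zero_mem, hiffH]
  have hTH : ∀ v ∈ V, ∀ x ∈ H, (Γ.Top pH pV v (Γ.J x) = Γ.J (Γ.Top pH pV v x) ↔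
      pV (Γ.nJ v x) = 0) := fun v hv x hx => by
    simp [APH.Top, hVV hv, hHH hx, hHH (hJH x hx), nabla_zero, hHH H.zero_mem, hiffV]
  have hTV : ∀ u ∈ V, ∀ v ∈ V, (Γ.Top pH pV u (Γ.J v) = Γ.J (Γ.Top pH pV u v) ↔
      pH (Γ.nJ u v) = 0) := fun u hu v hv => by
    simp [APH.Top, hVV hu, hVV hv, hVV (hJV v hv), nabla_zero, hHH H.zero_mem, hiffH]
  constructor
  · intro hK
    have hH0 (x y : X) : pH (Γ.nJ x y) = 0 := by rw [hK, (hHH H.zero_mem).1]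
    have hV0 (x y : X) : pV (Γ.nJ x y) = 0 := by rw [hK, (hHH H.zero_mem).2]
    exact ⟨fun _ _ _ _ => hH0 _ _, fun _ _ _ _ => hH0 _ _, fun _ _ _ _ => hV0 _ _,
      fun _ _ _ _ => hV0 _ _, fun x hx y hy => (hAH x hx y hy).2 (hV0 _ _),
      fun x hx v hv => (hAV x hx v hv).2 (hH0 _ _), fun v hv x hx => (hTH v hv x hx).2 (hV0 _ _),
      fun u hu v hv => (hTV u hu v hv).2 (hH0 _ _)⟩
  · rintro ⟨hHHH, hVHH, hVVV, hHVV, hA₁, hA₂, hT₁, hT₂⟩ x y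
    have hzero {z : X} (h₁ : pH z = 0) (h₂ : pV z = 0) : z = 0 := by
      rw [← hsum z, h₁, h₂, add_zero]
    have hx := hpH x
    have hx' := hpV x
    have hy := hpH y
    have hy' := hpV y
    rw [← hsum x, ← hsum y, nJ_addL, nJ_addR, nJ_addR,
      hzero (hHHH _ hx _ hy) ((hAH _ hx _ hy).1 (hA₁ _ hx _ hy)),
      hzero ((hAV _ hx _ hy').1 (hA₂ _ hx _ hy')) (hHVV _ hx _ hy'),
      hzero (hVHH _ hx' _ hy) ((hTH _ hx' _ hy).1 (hT₁ _ hx' _ hy)),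
      hzero ((hTV _ hx' _ hy').1 (hT₂ _ hx' _ hy')) (hVVV _ hx' _ hy')]
    simp
end
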